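/- arXiv:2003.12335 — 3 statements merged into one kernel-verified Lean document; each statement's English description precedes it below -/
import Mathlib

section
/- Let Ω be a proper subdomain of ℂ, let w ∈ Ω, and let s be a point of the open unit disk 𝔻. Let H_s(w,Ω) denote the family of all holomorphic functions h : 𝔻 → Ω with h(s) = w, h(t) ≠ w for all t ∈ 𝔻∖{s}, and h'(s) > 0. Then sup{h'(s) : h ∈ H_s(w,Ω)} = r_Ω(w)/(1−|s|²), i.e. the extremal derivative at s equals λ_𝔻(s)/η_Ω(w), where λ_𝔻(s) = 2/(1−|s|²) is the hyperbolic density of 𝔻. -/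
open Complex Set Metric
open scoped ENNReal

noncomputable section

/-- The open unit disk in the complex plane. -/
def unitDisk : Set ℂ := Metric.ball (0 : ℂ) 1

/-- A plane domain: a nonempty open connected subset of ℂ. -/
def IsPlaneDomain (S : Set ℂ) : Prop := IsOpen S ∧ IsConnected S

/-- The Hurwitz radius `r_Ω(w)`: the supremum of `h'(0)` over all holomorphic
`h : 𝔻 → Ω` with `h 0 = w`, `h t ≠ w` for `t ∈ 𝔻 \ {0}`, and `h'(0) > 0` (real). -/
def hurwitzRadius (Ω : Set ℂ) (w : ℂ) : ℝ :=
  sSup { r : ℝ | 0 < r ∧ ∃ h : ℂ → ℂ, DifferentiableOn ℂ h unitDisk ∧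
    Set.MapsTo h unitDisk Ω ∧ h 0 = w ∧ (∀ t ∈ unitDisk, t ≠ 0 → h t ≠ w) ∧
    deriv h 0 = (r : ℂ) }

/-- The Hurwitz density `η_Ω(w) = 2 / r_Ω(w)`. -/
def hurwitzDensity (Ω : Set ℂ) (w : ℂ) : ℝ := 2 / hurwitzRadius Ω w

/-- A (C¹, hence rectifiable) path in `Ω` from `w₁` to `w₂`, parametrized on `[0,1]`. -/
def IsPathIn (Ω : Set ℂ) (w₁ w₂ : ℂ) (γ : ℝ → ℂ) : Prop :=
  γ 0 = w₁ ∧ γ 1 = w₂ ∧ (∀ t ∈ Set.Icc (0:ℝ) 1, γ t ∈ Ω) ∧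
    ContDiffOn ℝ 1 γ (Set.Icc (0:ℝ) 1)

/-- The Hurwitz distance: infimum of Hurwitz lengths of rectifiable paths in `Ω`. -/
def hurwitzDist (Ω : Set ℂ) (w₁ w₂ : ℂ) : ℝ :=
  sInf { L : ℝ | ∃ γ : ℝ → ℂ, IsPathIn Ω w₁ w₂ γ ∧
    L = ∫ t in (0:ℝ)..1, hurwitzDensity Ω (γ t) * ‖derivWithin γ (Set.Icc (0:ℝ) 1) t‖ }

/-- The generalized Hurwitz density `η_Ω^Y(w)` with basepoint domain `Y`
(`+∞` if no admissible map exists). -/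
def genHurwitzDensity (Y Ω : Set ℂ) (w : ℂ) : ℝ≥0∞ :=
  sInf { x : ℝ≥0∞ | ∃ s ∈ Y, ∃ h : ℂ → ℂ, DifferentiableOn ℂ h Y ∧
    Set.MapsTo h Y Ω ∧ h s = w ∧ (∀ t ∈ Y, t ≠ s → h t ≠ w) ∧ deriv h s ≠ 0 ∧
    x = ENNReal.ofReal (hurwitzDensity Y s / ‖deriv h s‖) }

/-- The generalized Hurwitz distance `η_Ω^Y(z₁,z₂)`. -/
def genHurwitzDist (Y Ω : Set ℂ) (z₁ z₂ : ℂ) : ℝ≥0∞ :=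
  sInf { L : ℝ≥0∞ | ∃ γ : ℝ → ℂ, IsPathIn Ω z₁ z₂ γ ∧
    L = ∫⁻ t in Set.Icc (0:ℝ) 1,
      genHurwitzDensity Y Ω (γ t) * ENNReal.ofReal ‖derivWithin γ (Set.Icc (0:ℝ) 1) t‖ }

/-- The infinitesimal contraction constant `l_η(Ω, Y)`. -/
def lEta (Ω Y : Set ℂ) : ℝ :=
  sSup { x : ℝ | ∃ w ∈ Ω, x = hurwitzDensity Y w / hurwitzDensity Ω w }

/-- The global contraction constant `gl_η(Ω, Y)`. -/
def glEta (Ω Y : Set ℂ) : ℝ :=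
  sSup { x : ℝ | ∃ w₁ ∈ Ω, ∃ w₂ ∈ Ω, w₁ ≠ w₂ ∧
    x = hurwitzDist Y w₁ w₂ / hurwitzDist Ω w₁ w₂ }

/-- The disk automorphism `z ↦ (z + a) / (1 + conj a * z)`, which sends `0` to `a`. -/
def diskTranslation (a z : ℂ) : ℂ := (z + a) / (1 + starRingEnd ℂ a * z)

lemma mem_unitDisk {z : ℂ} : z ∈ unitDisk ↔ ‖z‖ < 1 := by
  simp [unitDisk]

lemma one_add_conj_mul_ne_zero {a z : ℂ} (ha : a ∈ unitDisk) (hz : z ∈ unitDisk) :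
    1 + starRingEnd ℂ a * z ≠ 0 := by
  rw [mem_unitDisk] at ha hz
  intro h
  have h1 : starRingEnd ℂ a * z = -1 := by linear_combination h
  have h2 : ‖a‖ * ‖z‖ = 1 := by simpa using congrArg norm h1
  nlinarith [norm_nonneg a, norm_nonneg z]

lemma diskTranslation_mem {a z : ℂ} (ha : a ∈ unitDisk) (hz : z ∈ unitDisk) :
    diskTranslation a z ∈ unitDisk := by
  have hne := one_add_conj_mul_ne_zero ha hz
  rw [mem_unitDisk] at ha hz ⊢
  rw [diskTranslation, norm_div, div_lt_one (norm_pos_iff.mpr hne)]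
  refine lt_of_pow_lt_pow_left₀ 2 (norm_nonneg _) ?_
  have ha2 : ‖a‖ ^ 2 < 1 := by nlinarith [norm_nonneg a]
  have hz2 : ‖z‖ ^ 2 < 1 := by nlinarith [norm_nonneg z]
  rw [← Complex.normSq_eq_norm_sq, Complex.normSq_apply] at ha2 hz2 ⊢
  rw [← Complex.normSq_eq_norm_sq, Complex.normSq_apply]
  simp only [add_re, add_im, one_re, one_im, mul_re, mul_im, conj_re, conj_im]
  nlinarith [mul_pos (sub_pos.mpr ha2) (sub_pos.mpr hz2)]

lemma neg_mem_unitDisk {a : ℂ} (ha : a ∈ unitDisk) : -a ∈ unitDisk := by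
  simpa [mem_unitDisk] using ha

lemma hasDerivAt_diskTranslation {a z : ℂ} (ha : a ∈ unitDisk) (hz : z ∈ unitDisk) :
    HasDerivAt (diskTranslation a)
      ((1 - a * starRingEnd ℂ a) / (1 + starRingEnd ℂ a * z) ^ 2) z := by
  have h := ((hasDerivAt_id z).add_const a).div
    (((hasDerivAt_id z).const_mul (starRingEnd ℂ a)).const_add 1)
    (one_add_conj_mul_ne_zero ha hz)
  refine h.congr_deriv ?_
  simp only [id]
  congr 1
  ring

lemma diskTranslation_injOn {a : ℂ} (ha : a ∈ unitDisk) :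
    Set.InjOn (diskTranslation a) unitDisk := by
  intro x hx y hy hxy
  have hx' := one_add_conj_mul_ne_zero ha hx
  have hy' := one_add_conj_mul_ne_zero ha hy
  have hne : 1 + starRingEnd ℂ a * (-a) ≠ 0 :=
    one_add_conj_mul_ne_zero ha (neg_mem_unitDisk ha)
  rw [diskTranslation, diskTranslation, div_eq_div_iff hx' hy'] at hxy
  refine sub_eq_zero.mp ((mul_eq_zero.mp ?_).resolve_left hne)
  linear_combination hxy

/-- The values `r > 0` occurring as `h'(s)` for holomorphic `h : 𝔻 → Ω` taking the value `w`
exactly at `s`. -/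
def derivValues (Ω : Set ℂ) (w s : ℂ) : Set ℝ :=
  { r : ℝ | 0 < r ∧ ∃ h : ℂ → ℂ, DifferentiableOn ℂ h unitDisk ∧
    Set.MapsTo h unitDisk Ω ∧ h s = w ∧ (∀ t ∈ unitDisk, t ≠ s → h t ≠ w) ∧
    deriv h s = (r : ℂ) }

/-- Precomposition with a disk automorphism moves the base point and rescales the derivative. -/
lemma mul_mem_derivValues {Ω : Set ℂ} {w a p q : ℂ} {r c : ℝ} (ha : a ∈ unitDisk)
    (hp : p ∈ unitDisk) (hq : q ∈ unitDisk) (hqp : diskTranslation a q = p) (hc : 0 < c)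
    (hd : HasDerivAt (diskTranslation a) (c : ℂ) q) (hr : r ∈ derivValues Ω w p) :
    c * r ∈ derivValues Ω w q := by
  obtain ⟨hr0, h, hdiff, hmaps, hval, hne, hder⟩ := hr
  refine ⟨mul_pos hc hr0, h ∘ diskTranslation a, ?_, ?_, ?_, ?_, ?_⟩
  · exact hdiff.comp
      (fun z hz => (hasDerivAt_diskTranslation ha hz).differentiableAt.differentiableWithinAt)
      (fun z hz => diskTranslation_mem ha hz)
  · exact fun z hz => hmaps (diskTranslation_mem ha hz)
  · simp [hqp, hval]
  · intro t ht htq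
    refine hne _ (diskTranslation_mem ha ht) fun htp => htq ?_
    exact diskTranslation_injOn ha ht hq (htp.trans hqp.symm)
  · have hh : HasDerivAt h (r : ℂ) (diskTranslation a q) := by
      rw [hqp, ← hder]
      exact (hdiff.differentiableAt (Metric.isOpen_ball.mem_nhds hp)).hasDerivAt
    rw [(hh.comp q hd).deriv]
    push_cast
    ring

open scoped Pointwise in
lemma derivValues_eq_smul (Ω : Set ℂ) (w : ℂ) {s : ℂ} (hs : s ∈ unitDisk) :
    derivValues Ω w s = (1 - ‖s‖ ^ 2)⁻¹ • derivValues Ω w 0 := by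
  have h0 : (0 : ℂ) ∈ unitDisk := by simp [mem_unitDisk]
  have hpos : 0 < 1 - ‖s‖ ^ 2 := by
    have := mem_unitDisk.mp hs
    nlinarith [norm_nonneg s]
  have hposC : (1 : ℂ) - (‖s‖ : ℂ) ^ 2 ≠ 0 := by exact_mod_cast hpos.ne'
  ext r
  rw [Set.mem_inv_smul_set_iff₀ hpos.ne', smul_eq_mul]
  constructor
  · refine mul_mem_derivValues hs hs h0 (by simp [diskTranslation]) hpos ?_
    refine (hasDerivAt_diskTranslation hs h0).congr_deriv ?_
    simp [Complex.mul_conj']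
  · intro hr
    have hr' := mul_mem_derivValues (neg_mem_unitDisk hs) h0 hs
      (by simp [diskTranslation]) (inv_pos.mpr hpos) ?_ hr
    · rwa [inv_mul_cancel_left₀ hpos.ne'] at hr'
    refine (hasDerivAt_diskTranslation (neg_mem_unitDisk hs) hs).congr_deriv ?_
    have h1 : 1 + starRingEnd ℂ (-s) * s = 1 - (‖s‖ : ℂ) ^ 2 := by
      rw [← Complex.conj_mul', map_neg]
      ring
    have h2 : 1 - -s * starRingEnd ℂ (-s) = 1 - (‖s‖ : ℂ) ^ 2 := by
      rw [← Complex.conj_mul', map_neg]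
      ring
    rw [h1, h2]
    push_cast
    field_simp

/-- the extremal derivative at `s` for the family `H_s(w,Ω)` equals
`r_Ω(w)/(1-|s|²) = λ_𝔻(s)/η_Ω(w)`. -/
theorem hurwitz_extremal_derivative_at
    (Ω : Set ℂ) (hΩ : IsPlaneDomain Ω) (hΩp : Ω ≠ Set.univ)
    (w : ℂ) (hw : w ∈ Ω) (s : ℂ) (hs : s ∈ unitDisk) :
    sSup { r : ℝ | 0 < r ∧ ∃ h : ℂ → ℂ, DifferentiableOn ℂ h unitDisk ∧
        Set.MapsTo h unitDisk Ω ∧ h s = w ∧ (∀ t ∈ unitDisk, t ≠ s → h t ≠ w) ∧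
        deriv h s = (r : ℂ) }
      = hurwitzRadius Ω w / (1 - ‖s‖ ^ 2) ∧
    hurwitzRadius Ω w / (1 - ‖s‖ ^ 2) = (2 / (1 - ‖s‖ ^ 2)) / hurwitzDensity Ω w := by
  have hnonneg : 0 ≤ 1 - ‖s‖ ^ 2 := by
    have := mem_unitDisk.mp hs
    nlinarith [norm_nonneg s]
  constructor
  · change sSup (derivValues Ω w s) = sSup (derivValues Ω w 0) / (1 - ‖s‖ ^ 2)
    rw [derivValues_eq_smul Ω w hs, Real.sSup_smul_of_nonneg (inv_nonneg.mpr hnonneg),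
      smul_eq_mul, div_eq_inv_mul]
  · rw [hurwitzDensity, div_div_div_cancel_left' _ _ two_ne_zero]
end
end

section
/- If Ω is a hyperbolic domain in ℂ, then the Hurwitz distance η_Ω(·,·) makes Ω a complete metric space: η_Ω(w₁,w₂) is symmetric, satisfies the triangle inequality, is strictly positive for distinct points w₁ ≠ w₂ of Ω, and every η_Ω-Cauchy sequence in Ω converges to a point of Ω. -/
open Complex Set Metric
open scoped ENNReal

noncomputable section

/-- A nonvanishing holomorphic function on a disk has a holomorphic logarithm with prescribed
value at the origin. -/
theorem exists_log_of_ne_zero {f : ℂ → ℂ} (hf : DifferentiableOn ℂ f unitDisk)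
    (hf0 : ∀ z ∈ unitDisk, f z ≠ 0) {y : ℂ} (hy : Complex.exp y = f 0) :
    ∃ g : ℂ → ℂ, DifferentiableOn ℂ g unitDisk ∧ g 0 = y ∧
      ∀ z ∈ unitDisk, Complex.exp (g z) = f z := by
  have hopen : IsOpen unitDisk := isOpen_ball
  have h0 : (0 : ℂ) ∈ unitDisk := mem_ball_self one_pos
  obtain ⟨g, hg0, hg⟩ := Complex.IsExactOn.with_val_at
    (DifferentiableOn.isExactOn_ball ((hf.deriv hopen).div hf hf0)) 0 y
  refine ⟨g, fun z hz => (hg z hz).differentiableAt.differentiableWithinAt, hg0, ?_⟩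
  have hder : ∀ z ∈ unitDisk, HasDerivAt (fun z => Complex.exp (g z) / f z) 0 z := by
    intro z hz
    have h1 := ((hg z hz).cexp).div
      (hf.differentiableAt (hopen.mem_nhds hz)).hasDerivAt (hf0 z hz)
    rw [Pi.div_apply, mul_assoc, div_mul_cancel₀ _ (hf0 z hz), sub_self, zero_div] at h1
    exact h1
  intro z hz
  have := hopen.is_const_of_deriv_eq_zero (convex_ball (0 : ℂ) 1).isPreconnected
    (fun w hw => (hder w hw).differentiableAt.differentiableWithinAt)
    (fun w hw => (hder w hw).deriv) hz h0
  simp only [hg0, hy, div_self (hf0 0 h0)] at this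
  rwa [div_eq_one_iff_eq (hf0 z hz)] at this

/-- A weak form of **Bloch's theorem**. -/
theorem exists_ball_subset_image {g : ℂ → ℂ} (hg : DifferentiableOn ℂ g unitDisk) :
    ∃ c, ball c (‖deriv g 0‖ / 128) ⊆ g '' unitDisk := by
  rcases eq_or_ne (deriv g 0) 0 with h0 | h0
  · exact ⟨0, by simp [h0]⟩
  have hopen : IsOpen unitDisk := isOpen_ball
  have hsub : closedBall (0 : ℂ) (1 / 2) ⊆ unitDisk := closedBall_subset_ball (by norm_num)
  have hg' := hg.deriv hopen
  obtain ⟨z₀, hz₀, hmax⟩ := (isCompact_closedBall (0 : ℂ) (1 / 2)).exists_isMaxOn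
    (f := fun z => (1 / 2 - ‖z‖) * ‖deriv g z‖) ⟨0, by simp⟩
    ((continuousOn_const.sub continuousOn_id.norm).mul (hg'.continuousOn.mono hsub).norm)
  have hM : 1 / 2 * ‖deriv g 0‖ ≤ (1 / 2 - ‖z₀‖) * ‖deriv g z₀‖ := by
    have h := hmax (show (0 : ℂ) ∈ closedBall (0 : ℂ) (1 / 2) by simp)
    simpa using h
  have hpos : 0 < ‖deriv g 0‖ := norm_pos_iff.2 h0
  set A := ‖deriv g z₀‖ with hA
  set τ := (1 / 2 - ‖z₀‖) / 2 with hτ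
  have hA0 : 0 ≤ A := norm_nonneg _
  have hz₀' : ‖z₀‖ ≤ 1 / 2 := by simpa using hz₀
  have hτA : ‖deriv g 0‖ / 4 ≤ A * τ := by rw [hτ]; linarith
  have hτ0 : 0 < τ := by
    rcases (show 0 ≤ τ by rw [hτ]; linarith).eq_or_lt with h | h
    · rw [← h] at hτA; linarith
    · exact h
  have hApos : 0 < A := by
    rcases hA0.eq_or_lt with h | h
    · rw [← h] at hτA; linarith
    · exact h
  have hball : ball z₀ τ ⊆ closedBall (0 : ℂ) (1 / 2) := by
    intro z hz
    have h1 : ‖z - z₀‖ < τ := by simpa [dist_eq_norm] using hz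
    have h2 := norm_sub_norm_le z z₀
    simp only [mem_closedBall, dist_zero_right]
    linarith
  have hbound : ∀ z ∈ ball z₀ τ, ‖deriv g z‖ ≤ 2 * A := by
    intro z hz
    have h1 : ‖z - z₀‖ < τ := by simpa [dist_eq_norm] using hz
    have h2 := norm_sub_norm_le z z₀
    have h3 : (1 / 2 - ‖z‖) * ‖deriv g z‖ ≤ (1 / 2 - ‖z₀‖) * A := hmax (hball hz)
    have h4 : τ * ‖deriv g z‖ ≤ τ * (2 * A) := by
      calc τ * ‖deriv g z‖ ≤ (1 / 2 - ‖z‖) * ‖deriv g z‖ := by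
            apply mul_le_mul_of_nonneg_right _ (norm_nonneg _); linarith
        _ ≤ (1 / 2 - ‖z₀‖) * A := h3
        _ = τ * (2 * A) := by rw [hτ]; ring
    exact le_of_mul_le_mul_left h4 hτ0
  have hschwarz : ∀ z ∈ ball z₀ τ, ‖deriv g z - deriv g z₀‖ ≤ 4 * A / τ * ‖z - z₀‖ := by
    intro z hz
    have := Complex.dist_le_div_mul_dist_of_mapsTo_ball (R₂ := 4 * A)
      (hg'.mono (hball.trans hsub)) (fun w hw => ?_) hz
    · simpa [dist_eq_norm] using this
    · rw [mem_closedBall, dist_eq_norm]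
      calc _ ≤ ‖deriv g w‖ + ‖deriv g z₀‖ := norm_sub_le _ _
        _ ≤ 2 * A + A := add_le_add (hbound w hw) le_rfl
        _ ≤ 4 * A := by linarith
  have hsmall : closedBall z₀ (τ / 8) ⊆ ball z₀ τ := closedBall_subset_ball (by linarith)
  have hlow : ∀ z ∈ closedBall z₀ (τ / 8), A / 2 * ‖z - z₀‖ ≤ ‖g z - g z₀‖ := by
    intro z hz
    have hmv := (convex_closedBall z₀ (τ / 8)).norm_image_sub_le_of_norm_hasDerivWithin_le
      (f := fun z => g z - deriv g z₀ * z) (f' := fun z => deriv g z - deriv g z₀) (C := A / 2)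
      (fun w hw => ?_) (fun w hw => ?_) (mem_closedBall_self (by positivity)) hz
    · have h1 : ‖deriv g z₀ * (z - z₀)‖ = A * ‖z - z₀‖ := norm_mul _ _
      have h2 : deriv g z₀ * (z - z₀) = (g z - g z₀)
          - (g z - deriv g z₀ * z - (g z₀ - deriv g z₀ * z₀)) := by ring
      have h3 := norm_sub_le (g z - g z₀)
        (g z - deriv g z₀ * z - (g z₀ - deriv g z₀ * z₀))
      rw [← h2, h1] at h3
      linarith
    · have h1 := (hg.differentiableAt
        (hopen.mem_nhds (hsub (hball (hsmall hw))))).hasDerivAt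
      have h2 := (h1.sub ((hasDerivAt_id w).const_mul (deriv g z₀))).hasDerivWithinAt
        (s := closedBall z₀ (τ / 8))
      rw [mul_one] at h2
      exact h2
    · refine (hschwarz w (hsmall hw)).trans ?_
      have h1 : ‖w - z₀‖ ≤ τ / 8 := by simpa [dist_eq_norm] using hw
      calc 4 * A / τ * ‖w - z₀‖ ≤ 4 * A / τ * (τ / 8) := by gcongr
        _ = A / 2 := by field_simp; norm_num
  have hdiff : DiffContOnCl ℂ g (ball z₀ (τ / 8)) := by
    apply DifferentiableOn.diffContOnCl
    rw [closure_ball _ (by positivity)]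
    exact hg.mono (hsmall.trans (hball.trans hsub))
  have hfreq : ∃ᶠ z in nhds z₀, g z ≠ g z₀ := by
    have hd := (hg.differentiableAt (hopen.mem_nhds (hsub hz₀))).hasDerivAt
    have := (hd.eventually_ne (c := g z₀) (norm_pos_iff.1 hApos)).frequently
    exact this.filter_mono nhdsWithin_le_nhds
  have himg := hdiff.ball_subset_image_closedBall (ε := A * τ / 16) (by positivity)
    (fun z hz => ?_) hfreq
  · refine ⟨g z₀, (ball_subset_ball ?_).trans (himg.trans
      (image_mono (hsmall.trans (hball.trans hsub))))⟩
    linarith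
  · have h1 : ‖z - z₀‖ = τ / 8 := by simpa [dist_eq_norm] using hz
    have h2 := hlow z (sphere_subset_closedBall hz)
    rw [h1] at h2
    linarith

theorem exists_cosh_eq_natCast {y : ℝ} (hy : 0 ≤ y) :
    ∃ x : ℝ, |x - y| ≤ 2 ∧ ∃ n : ℕ, n ≠ 0 ∧ Real.cosh x = n := by
  have h1 : Real.cosh y + 1 ≤ Real.cosh (y + 2) := by
    rw [Real.cosh_add]
    have h2 : 1 ≤ Real.cosh y := Real.one_le_cosh y
    have h3 : 0 ≤ Real.sinh y := Real.sinh_nonneg_iff.2 hy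
    have h4 : 0 ≤ Real.sinh 2 := Real.sinh_nonneg_iff.2 (by norm_num)
    have h5 : 2 ≤ Real.cosh 2 := by
      have h6 := Real.quadratic_le_exp_of_nonneg (show (0:ℝ) ≤ 2 by norm_num)
      have h7 := Real.exp_pos (-2)
      rw [Real.cosh_eq]
      linarith
    nlinarith [mul_nonneg h3 h4]
  obtain ⟨x, hx, hxn⟩ := intermediate_value_Icc (show y ≤ y + 2 by linarith)
    Real.continuous_cosh.continuousOn
    (show ((⌈Real.cosh y⌉₊ : ℕ) : ℝ) ∈ Icc (Real.cosh y) (Real.cosh (y + 2)) from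
      ⟨Nat.le_ceil _, ((Nat.ceil_lt_add_one (Real.cosh_pos y).le).le).trans h1⟩)
  refine ⟨x, by rw [abs_le]; constructor <;> linarith [hx.1, hx.2], _, ?_, hxn⟩
  exact (Nat.ceil_pos.2 (Real.cosh_pos y)).ne'

/-- The points where the cosine takes a nonzero integer value form a net in the plane. -/
theorem exists_cos_eq_intCast_near (c : ℂ) :
    ∃ p ∈ ball c 4, ∃ n : ℤ, n ≠ 0 ∧ Complex.cos p = n := by
  obtain ⟨x, hx, n, hn, hxn⟩ := exists_cosh_eq_natCast (abs_nonneg c.im)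
  obtain ⟨s, hs, hsn⟩ : ∃ s : ℝ, |s - c.im| ≤ 2 ∧ Real.cosh s = n := by
    rcases abs_cases c.im with ⟨h, -⟩ | ⟨h, -⟩
    · exact ⟨x, by rwa [← h], hxn⟩
    · refine ⟨-x, ?_, by rwa [Real.cosh_neg]⟩
      rw [h] at hx
      rw [← abs_neg]
      convert hx using 2
      ring
  have hπ := Real.pi_pos
  have hπ4 := Real.pi_lt_four
  set m : ℤ := round (c.re / Real.pi) with hm
  have hr : |m * Real.pi - c.re| ≤ Real.pi / 2 := by
    have h := abs_sub_round (c.re / Real.pi)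
    rw [← hm] at h
    have h2 : (m : ℝ) * Real.pi - c.re = -((c.re / Real.pi - m) * Real.pi) := by
      field_simp
      ring
    rw [h2, abs_neg, abs_mul, abs_of_pos hπ]
    nlinarith
  refine ⟨((m * Real.pi : ℝ) : ℂ) + (s : ℂ) * I, ?_, ?_⟩
  · rw [mem_ball, dist_eq_norm]
    refine (Complex.norm_le_abs_re_add_abs_im _).trans_lt ?_
    simp only [sub_re, add_re, ofReal_re, mul_re, I_re, ofReal_im, I_im, sub_im, add_im, mul_im]
    simp only [mul_zero, mul_one, sub_zero, add_zero, zero_add]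
    linarith
  · obtain ⟨e, he, hem⟩ : ∃ e : ℤ, e ≠ 0 ∧ Real.cos (m * Real.pi) = e := by
      rw [Real.cos_int_mul_pi]
      rcases m.even_or_odd with h | h
      · exact ⟨1, one_ne_zero, by simp [h.neg_one_zpow]⟩
      · exact ⟨-1, by norm_num, by simp [h.neg_one_zpow]⟩
    have hs' : Complex.cosh (s : ℂ) = n := by
      rw [← Complex.ofReal_cosh, hsn]; simp
    refine ⟨e * n, mul_ne_zero he (by exact_mod_cast hn), ?_⟩
    rw [Complex.cos_add, Complex.cos_mul_I, ← Complex.ofReal_cos, hem, ← Complex.ofReal_sin,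
      Real.sin_int_mul_pi, hs']
    simp

/-- A **Landau**-type theorem: the derivative at the zero of a holomorphic function on the disk
omitting all nonzero integers is bounded by an absolute constant. -/
theorem norm_deriv_le_of_omits_int {u : ℂ → ℂ} (hu : DifferentiableOn ℂ u unitDisk)
    (hu0 : u 0 = 0) (homit : ∀ z ∈ unitDisk, ∀ n : ℤ, n ≠ 0 → u z ≠ n) :
    ‖deriv u 0‖ ≤ 512 := by
  have hopen : IsOpen unitDisk := isOpen_ball
  have h0 : (0 : ℂ) ∈ unitDisk := mem_ball_self one_pos
  have hne : ∀ z ∈ unitDisk, u z ^ 2 - 1 ≠ 0 := by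
    intro z hz h
    have h1 := homit z hz 1 (by norm_num)
    have h2 := homit z hz (-1) (by norm_num)
    push_cast at h1 h2
    rcases mul_eq_zero.1 (show (u z - 1) * (u z - (-1)) = 0 by rw [← h]; ring) with h3 | h3
    · exact h1 (sub_eq_zero.1 h3)
    · exact h2 (sub_eq_zero.1 h3)
  obtain ⟨l, hl, -, hlexp⟩ := exists_log_of_ne_zero ((hu.pow 2).sub_const 1) hne
    (Complex.exp_log (hne 0 h0))
  set q : ℂ → ℂ := fun z => Complex.exp (l z / 2) with hq
  have hqd : DifferentiableOn ℂ q unitDisk := (hl.div_const 2).cexp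
  have hq2 : ∀ z ∈ unitDisk, (u z + q z) * (u z - q z) = 1 := by
    intro z hz
    have h1 : q z * q z = u z ^ 2 - 1 := by
      rw [hq, ← Complex.exp_add, add_halves]
      exact hlexp z hz
    linear_combination -h1
  have hv0 : ∀ z ∈ unitDisk, u z + q z ≠ 0 := fun z hz => left_ne_zero_of_mul_eq_one (hq2 z hz)
  obtain ⟨k, hk, -, hkexp⟩ := exists_log_of_ne_zero (hu.add hqd) hv0
    (Complex.exp_log (hv0 0 h0))
  set g : ℂ → ℂ := fun z => k z * (-I) with hg
  have hgd : DifferentiableOn ℂ g unitDisk := hk.mul_const _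
  have hcos : ∀ z ∈ unitDisk, Complex.cos (g z) = u z := by
    intro z hz
    have h1 : g z * I = k z := by
      rw [hg]
      linear_combination (-k z) * I_mul_I
    have h2 := hkexp z hz
    simp only [Pi.add_apply] at h2
    have h3 : (u z + q z)⁻¹ = u z - q z := inv_eq_of_mul_eq_one_right (hq2 z hz)
    rw [Complex.cos, neg_mul, h1, Complex.exp_neg, h2, h3]
    ring
  have hderiv : ‖deriv u 0‖ = ‖deriv g 0‖ := by
    have h1 := (hgd.differentiableAt (hopen.mem_nhds h0)).hasDerivAt.ccos
    have h2 : deriv u 0 = -Complex.sin (g 0) * deriv g 0 := by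
      refine HasDerivAt.deriv (h1.congr_of_eventuallyEq ?_)
      filter_upwards [hopen.mem_nhds h0] with z hz using (hcos z hz).symm
    have h3 : Complex.sin (g 0) ^ 2 = 1 := by
      have := Complex.sin_sq_add_cos_sq (g 0)
      rw [hcos 0 h0, hu0] at this
      simpa using this
    have h4 : ‖Complex.sin (g 0)‖ = 1 := by
      have := congrArg norm h3
      rw [norm_pow, norm_one] at this
      exact (pow_eq_one_iff_of_nonneg (norm_nonneg _) two_ne_zero).1 this
    rw [h2, norm_mul, norm_neg, h4, one_mul]
  rw [hderiv]
  by_contra! hlt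
  obtain ⟨c, hc⟩ := exists_ball_subset_image hgd
  obtain ⟨p, hp, n, hn, hpn⟩ := exists_cos_eq_intCast_near c
  obtain ⟨z, hz, rfl⟩ := hc (ball_subset_ball (by linarith) hp)
  exact homit z hz n hn (by rw [← hcos z hz, hpn])

/-- A weak form of **Hurwitz's theorem** on holomorphic maps with a single simple zero. -/
theorem norm_deriv_le_of_omits {h : ℂ → ℂ} {w a : ℂ} (hd : DifferentiableOn ℂ h unitDisk)
    (h0 : h 0 = w) (hw : ∀ t ∈ unitDisk, t ≠ 0 → h t ≠ w) (ha : ∀ t ∈ unitDisk, h t ≠ a) :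
    ‖deriv h 0‖ ≤ 4096 * ‖w - a‖ := by
  have hopen : IsOpen unitDisk := isOpen_ball
  have hz0 : (0 : ℂ) ∈ unitDisk := mem_ball_self one_pos
  have hwa : w - a ≠ 0 := sub_ne_zero.2 (h0 ▸ ha 0 hz0)
  obtain ⟨f, hf, hf0, hfexp⟩ := exists_log_of_ne_zero ((hd.sub_const a).div_const (w - a))
    (fun z hz => div_ne_zero (sub_ne_zero.2 (ha z hz)) hwa) (y := 0) (by simp [h0, hwa])
  have hπ : (2 * Real.pi * I : ℂ) ≠ 0 := Complex.two_pi_I_ne_zero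
  have hbound := norm_deriv_le_of_omits_int (u := fun z => f z / (2 * Real.pi * I))
    (hf.div_const _) (by simp [hf0]) (by
      intro z hz n hn hzn
      have h1 : f z = n * (2 * Real.pi * I) := (div_eq_iff hπ).1 hzn
      have h2 := hfexp z hz
      rw [h1, Complex.exp_int_mul_two_pi_mul_I, eq_comm, div_eq_one_iff_eq hwa] at h2
      have h3 : h z = w := by linear_combination h2
      have h4 : z = 0 := by
        by_contra h5
        exact hw z hz h5 h3
      rw [h4, hf0] at h1
      rcases mul_eq_zero.1 h1.symm with h5 | h5
      · exact hn (by exact_mod_cast h5)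
      · exact hπ h5)
  have hder : deriv h 0 / (w - a) = deriv f 0 := by
    have h1 := (hf.differentiableAt (hopen.mem_nhds hz0)).hasDerivAt.cexp
    have h2 := ((hd.differentiableAt (hopen.mem_nhds hz0)).hasDerivAt.sub_const a).div_const (w - a)
    have h3 := h1.unique (h2.congr_of_eventuallyEq (by
      filter_upwards [hopen.mem_nhds hz0] with z hz using hfexp z hz))
    rw [← h3, hf0]
    simp
  rw [deriv_div_const, ← hder, norm_div, norm_div, div_div] at hbound
  have hn : ‖(2 * Real.pi * I : ℂ)‖ = 2 * Real.pi := by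
    simp [abs_of_pos Real.pi_pos]
  have hpos : 0 < ‖w - a‖ := norm_pos_iff.2 hwa
  have hπ0 := Real.pi_pos
  rw [hn, div_le_iff₀ (by positivity)] at hbound
  have := Real.pi_lt_four
  nlinarith

/-- Values of `h'(0)` over the competing family are controlled by the distance to any omitted
point. -/
theorem bddAbove_hurwitz_competitors {Ω : Set ℂ} {a : ℂ} (ha : a ∉ Ω) (w : ℂ) {r : ℝ}
    (hr : r ∈ { r : ℝ | 0 < r ∧ ∃ h : ℂ → ℂ, DifferentiableOn ℂ h unitDisk ∧
      Set.MapsTo h unitDisk Ω ∧ h 0 = w ∧ (∀ t ∈ unitDisk, t ≠ 0 → h t ≠ w) ∧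
      deriv h 0 = (r : ℂ) }) : r ≤ 4096 * ‖w - a‖ := by
  obtain ⟨hr0, h, hd, hm, h0, hw, hder⟩ := hr
  have := norm_deriv_le_of_omits hd h0 hw
    (fun t ht => ne_of_mem_of_not_mem (hm ht) ha)
  rwa [hder, Complex.norm_real, Real.norm_of_nonneg hr0.le] at this

theorem hurwitzRadius_nonneg (Ω : Set ℂ) (w : ℂ) : 0 ≤ hurwitzRadius Ω w :=
  Real.sSup_nonneg fun _ hr => hr.1.le

theorem hurwitzDensity_nonneg (Ω : Set ℂ) (w : ℂ) : 0 ≤ hurwitzDensity Ω w :=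
  div_nonneg zero_le_two (hurwitzRadius_nonneg Ω w)

theorem hurwitzRadius_le {Ω : Set ℂ} {a : ℂ} (ha : a ∉ Ω) (w : ℂ) :
    hurwitzRadius Ω w ≤ 4096 * ‖w - a‖ :=
  Real.sSup_le (fun _ hr => bddAbove_hurwitz_competitors ha w hr) (by positivity)

theorem hurwitzRadius_of_notMem {Ω : Set ℂ} {w : ℂ} (hw : w ∉ Ω) : hurwitzRadius Ω w = 0 := by
  unfold hurwitzRadius
  convert Real.sSup_empty
  rw [Set.eq_empty_iff_forall_notMem]
  rintro r ⟨-, h, -, hm, h0, -⟩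
  exact hw (h0 ▸ hm (mem_ball_self one_pos))

theorem norm_deriv_le_hurwitzRadius {Ω : Set ℂ} {a w : ℂ} (ha : a ∉ Ω) {h : ℂ → ℂ}
    (hd : DifferentiableOn ℂ h unitDisk) (hm : MapsTo h unitDisk Ω) (h0 : h 0 = w)
    (hw : ∀ t ∈ unitDisk, t ≠ 0 → h t ≠ w) : ‖deriv h 0‖ ≤ hurwitzRadius Ω w := by
  rcases eq_or_ne (deriv h 0) 0 with h' | h'
  · rw [h', norm_zero]
    exact hurwitzRadius_nonneg Ω w
  have hpos : 0 < ‖deriv h 0‖ := norm_pos_iff.2 h'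
  have hn : (‖deriv h 0‖ : ℂ) ≠ 0 := by exact_mod_cast hpos.ne'
  set c : ℂ := ‖deriv h 0‖ / deriv h 0 with hc
  have hc1 : ‖c‖ = 1 := by
    rw [hc, norm_div, Complex.norm_real, norm_norm, div_self hpos.ne']
  have hc0 : c ≠ 0 := div_ne_zero hn h'
  have hmaps : MapsTo (fun t => c * t) unitDisk unitDisk := by
    intro t ht
    simp only [unitDisk, mem_ball, dist_zero_right] at ht ⊢
    rwa [norm_mul, hc1, one_mul]
  refine le_csSup ⟨_, fun _ hr => bddAbove_hurwitz_competitors ha w hr⟩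
    ⟨hpos, fun t => h (c * t), ?_, hm.comp hmaps, by simp [h0], ?_, ?_⟩
  · exact hd.comp (differentiableOn_id.const_mul c) hmaps
  · exact fun t ht ht0 => hw _ (hmaps ht) (mul_ne_zero hc0 ht0)
  · rw [deriv_comp_mul_left]
    simp [hc, h']

theorem le_hurwitzRadius_of_ball_subset {Ω : Set ℂ} {a w : ℂ} (ha : a ∉ Ω) {ρ : ℝ} (hρ : 0 < ρ)
    (hb : ball w ρ ⊆ Ω) : ρ ≤ hurwitzRadius Ω w := by
  have h := norm_deriv_le_hurwitzRadius (h := fun t => w + ρ * t) (w := w) ha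
    (by fun_prop) (fun t ht => hb ?_) (by simp) (fun t _ ht0 => ?_)
  · have hder : HasDerivAt (fun t : ℂ => w + ρ * t) ρ 0 := by
      simpa using ((hasDerivAt_id (0 : ℂ)).const_mul (ρ : ℂ)).const_add w
    rwa [hder.deriv, Complex.norm_real, Real.norm_of_nonneg hρ.le] at h
  · simp only [unitDisk, mem_ball, dist_zero_right] at ht
    simp only [mem_ball, dist_eq_norm, add_sub_cancel_left, norm_mul, Complex.norm_real,
      Real.norm_of_nonneg hρ.le]
    nlinarith
  · simp [ht0, hρ.ne']

theorem hurwitzDensity_le_of_ball_subset {Ω : Set ℂ} {a w : ℂ} (ha : a ∉ Ω) {ρ : ℝ} (hρ : 0 < ρ)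
    (hb : ball w ρ ⊆ Ω) : hurwitzDensity Ω w ≤ 2 / ρ :=
  div_le_div_of_nonneg_left zero_le_two hρ (le_hurwitzRadius_of_ball_subset ha hρ hb)

theorem hurwitzRadius_pos {Ω : Set ℂ} {a w : ℂ} (hΩ : IsOpen Ω) (ha : a ∉ Ω) (hw : w ∈ Ω) :
    0 < hurwitzRadius Ω w := by
  obtain ⟨ρ, hρ, hb⟩ := Metric.isOpen_iff.1 hΩ w hw
  exact hρ.trans_le (le_hurwitzRadius_of_ball_subset ha hρ hb)

theorem le_hurwitzDensity {Ω : Set ℂ} {a w : ℂ} (hΩ : IsOpen Ω) (ha : a ∉ Ω) (hw : w ∈ Ω) :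
    1 / (2048 * ‖w - a‖) ≤ hurwitzDensity Ω w := by
  have h1 := hurwitzRadius_pos hΩ ha hw
  have h2 := hurwitzRadius_le ha w
  have h3 : 0 < ‖w - a‖ := by linarith
  calc 1 / (2048 * ‖w - a‖) = 2 / (4096 * ‖w - a‖) := by field_simp; norm_num
    _ ≤ _ := div_le_div_of_nonneg_left zero_le_two h1 h2

/-- The Hurwitz radius is lower semicontinuous. -/
theorem lowerSemicontinuous_hurwitzRadius {Ω : Set ℂ} {a : ℂ} (ha : a ∉ Ω) :
    LowerSemicontinuous (hurwitzRadius Ω) := by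
  intro w y hy
  rcases lt_or_ge y 0 with hy0 | hy0
  · exact Filter.Eventually.of_forall fun v => hy0.trans_le (hurwitzRadius_nonneg Ω v)
  have hwΩ : w ∈ Ω := by
    by_contra hw
    rw [hurwitzRadius_of_notMem hw] at hy
    linarith
  have hopen : IsOpen unitDisk := isOpen_ball
  have hz0 : (0 : ℂ) ∈ unitDisk := mem_ball_self one_pos
  obtain ⟨r, ⟨hr0, h, hd, hm, h0, hw, hder⟩, hyr⟩ := exists_lt_of_lt_csSup (by
    by_contra hne
    rw [Set.not_nonempty_iff_eq_empty] at hne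
    rw [hurwitzRadius, hne, Real.sSup_empty] at hy
    linarith) hy
  obtain ⟨ρ, hρ, hρ1⟩ : ∃ ρ, y < ρ * r ∧ ρ < 1 := by
    obtain ⟨ρ, h1, h2⟩ := exists_between ((div_lt_one hr0).2 hyr)
    exact ⟨ρ, (div_lt_iff₀ hr0).1 h1, h2⟩
  have hρ0 : 0 < ρ := pos_of_mul_pos_left (hy0.trans_lt hρ) hr0.le
  have han : AnalyticAt ℂ h 0 := (hd.analyticOnNhd hopen) 0 hz0
  have hstrict : HasStrictDerivAt h (deriv h 0) 0 := han.contDiffAt.hasStrictDerivAt one_ne_zero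
  have hne : deriv h 0 ≠ 0 := by
    rw [hder]
    exact_mod_cast hr0.ne'
  set e := (hstrict.hasStrictFDerivAt_equiv hne).toOpenPartialHomeomorph h with he
  have heh : ∀ z, e z = h z := fun z => rfl
  have h0s : (0 : ℂ) ∈ e.source :=
    (hstrict.hasStrictFDerivAt_equiv hne).mem_toOpenPartialHomeomorph_source
  have hsub : closedBall (0 : ℂ) ρ ⊆ unitDisk := closedBall_subset_ball hρ1
  have hK : IsCompact (h '' (closedBall (0 : ℂ) ρ \ e.source)) :=
    ((isCompact_closedBall _ _).diff e.open_source).image_of_continuousOn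
      (hd.continuousOn.mono (sdiff_subset.trans hsub))
  have hwK : w ∉ h '' (closedBall (0 : ℂ) ρ \ e.source) := by
    rintro ⟨t, ⟨ht, hts⟩, htw⟩
    refine hw t (hsub ht) ?_ htw
    rintro rfl
    exact hts h0s
  have hwt : w ∈ e.target := by
    rw [← h0, ← heh]
    exact e.map_source h0s
  have hsymm0 : e.symm w = 0 := by
    rw [← h0, ← heh]
    exact e.left_inv h0s
  have hcont : Filter.Tendsto e.symm (nhds w) (nhds 0) := by
    have := e.continuousAt_symm hwt
    rwa [ContinuousAt, hsymm0] at this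
  have hderc : ContinuousAt (deriv h) 0 :=
    (hd.deriv hopen).continuousOn.continuousAt (hopen.mem_nhds hz0)
  have hlim : Filter.Tendsto (fun z : ℂ => (ρ - ‖z‖) * ‖deriv h z‖) (nhds 0) (nhds (ρ * r)) := by
    have h1 : ContinuousAt (fun z : ℂ => (ρ - ‖z‖) * ‖deriv h z‖) 0 :=
      (continuousAt_const.sub continuousAt_id.norm).mul hderc.norm
    have h2 := h1.tendsto
    simpa [hder, abs_of_pos hr0] using h2
  filter_upwards [e.open_target.mem_nhds hwt, hK.isClosed.isOpen_compl.mem_nhds hwK,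
    (hlim.comp hcont).eventually (lt_mem_nhds hρ),
    hcont.eventually (ball_mem_nhds (0 : ℂ) hρ0)] with v hv hvK hvy hvb
  refine lt_of_lt_of_le hvy ?_
  set z := e.symm v with hz
  have hzs : z ∈ e.source := e.map_target hv
  have hhz : h z = v := e.right_inv hv
  have hδ : 0 < ρ - ‖z‖ := by
    have h1 : ‖z‖ < ρ := by simpa using hvb
    linarith
  have hmaps : MapsTo (fun t : ℂ => z + (ρ - ‖z‖ : ℝ) * t) unitDisk (closedBall 0 ρ) := by
    intro t ht
    simp only [unitDisk, mem_ball, dist_zero_right] at ht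
    rw [mem_closedBall, dist_zero_right]
    refine (norm_add_le _ _).trans ?_
    rw [norm_mul, Complex.norm_real, Real.norm_of_nonneg hδ.le]
    nlinarith
  have hha : HasDerivAt (fun t : ℂ => z + (ρ - ‖z‖ : ℝ) * t) (ρ - ‖z‖ : ℝ) 0 := by
    simpa using ((hasDerivAt_id (0 : ℂ)).const_mul ((ρ - ‖z‖ : ℝ) : ℂ)).const_add z
  have hzd : z ∈ unitDisk := hsub (ball_subset_closedBall hvb)
  have hcomp : deriv (fun t => h (z + (ρ - ‖z‖ : ℝ) * t)) 0 = deriv h z * (ρ - ‖z‖ : ℝ) := by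
    have h1 := (hd.differentiableAt (hopen.mem_nhds hzd)).hasDerivAt
    refine HasDerivAt.deriv (HasDerivAt.comp (h₂ := h) (0 : ℂ) ?_ hha)
    simpa using h1
  have hle := norm_deriv_le_hurwitzRadius (w := v) (h := fun t => h (z + (ρ - ‖z‖ : ℝ) * t)) ha
    (hd.comp (by fun_prop) (fun t ht => hsub (hmaps ht)))
    (fun t ht => hm (hsub (hmaps ht))) (by simp [hhz]) (fun t ht ht0 htv => ?_)
  · rw [hcomp, norm_mul, Complex.norm_real, Real.norm_of_nonneg hδ.le, mul_comm] at hle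
    exact hle
  · have hts : z + (ρ - ‖z‖ : ℝ) * t ∈ e.source := by
      by_contra hns
      exact hvK ⟨_, ⟨hmaps ht, hns⟩, htv⟩
    have h1 := e.injOn hts hzs (by rw [heh, heh, htv, hhz])
    have h2 : ((ρ - ‖z‖ : ℝ) : ℂ) * t = 0 := by linear_combination h1
    rcases mul_eq_zero.1 h2 with h3 | h3
    · exact hδ.ne' (by exact_mod_cast h3)
    · exact ht0 h3

theorem measurable_hurwitzDensity {Ω : Set ℂ} {a : ℂ} (ha : a ∉ Ω) :
    Measurable (hurwitzDensity Ω) :=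
  (lowerSemicontinuous_hurwitzRadius ha).measurable.const_div 2

theorem intervalIntegrable_hurwitz {Ω : Set ℂ} {a w₁ w₂ : ℂ} (hΩ : IsOpen Ω) (ha : a ∉ Ω)
    {γ : ℝ → ℂ} (hγ : IsPathIn Ω w₁ w₂ γ) :
    IntervalIntegrable
      (fun t => hurwitzDensity Ω (γ t) * ‖derivWithin γ (Set.Icc (0 : ℝ) 1) t‖)
      MeasureTheory.volume 0 1 := by
  obtain ⟨-, -, hm, hc⟩ := hγ
  rw [intervalIntegrable_iff_integrableOn_Icc_of_le zero_le_one]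
  have hK : IsCompact (γ '' Icc (0 : ℝ) 1) := isCompact_Icc.image_of_continuousOn hc.continuousOn
  obtain ⟨δ, hδ, hthick⟩ := hK.exists_thickening_subset_open hΩ (image_subset_iff.2 hm)
  have hdc : ContinuousOn (derivWithin γ (Icc (0 : ℝ) 1)) (Icc 0 1) :=
    hc.continuousOn_derivWithin (uniqueDiffOn_Icc zero_lt_one) le_rfl
  obtain ⟨M, hM⟩ := isCompact_Icc.exists_bound_of_continuousOn hdc
  refine MeasureTheory.IntegrableOn.of_bound isCompact_Icc.measure_lt_top ?_ (2 / δ * M) ?_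
  · exact (((measurable_hurwitzDensity ha).comp_aemeasurable
      (hc.continuousOn.aemeasurable measurableSet_Icc)).mul
      (hdc.norm.aemeasurable measurableSet_Icc)).aestronglyMeasurable
  · refine (MeasureTheory.ae_restrict_iff' measurableSet_Icc).2
      (Filter.Eventually.of_forall fun t ht => ?_)
    have h1 : hurwitzDensity Ω (γ t) ≤ 2 / δ :=
      hurwitzDensity_le_of_ball_subset ha hδ
        ((ball_subset_thickening (mem_image_of_mem γ ht) δ).trans hthick)
    rw [norm_mul, norm_norm, Real.norm_of_nonneg (hurwitzDensity_nonneg Ω _)]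
    exact mul_le_mul h1 (hM t ht) (norm_nonneg _) (by positivity)

theorem zero_mem_lowerBounds_hurwitz_lengths (Ω : Set ℂ) (w₁ w₂ : ℂ) :
    0 ∈ lowerBounds { L : ℝ | ∃ γ : ℝ → ℂ, IsPathIn Ω w₁ w₂ γ ∧
      L = ∫ t in (0:ℝ)..1, hurwitzDensity Ω (γ t) * ‖derivWithin γ (Set.Icc (0:ℝ) 1) t‖ } := by
  rintro L ⟨γ, -, rfl⟩
  exact intervalIntegral.integral_nonneg zero_le_one
    fun t _ => mul_nonneg (hurwitzDensity_nonneg Ω _) (norm_nonneg _)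

theorem hurwitzDist_le {Ω : Set ℂ} {w₁ w₂ : ℂ} {γ : ℝ → ℂ} (hγ : IsPathIn Ω w₁ w₂ γ) :
    hurwitzDist Ω w₁ w₂ ≤
      ∫ t in (0:ℝ)..1, hurwitzDensity Ω (γ t) * ‖derivWithin γ (Set.Icc (0:ℝ) 1) t‖ :=
  csInf_le ⟨0, zero_mem_lowerBounds_hurwitz_lengths Ω w₁ w₂⟩ ⟨γ, hγ, rfl⟩

/-- A globally defined `C¹` path in `Ω` that is constant before time `0` and after time `1`. -/
structure IsStationaryPath (Ω : Set ℂ) (w₁ w₂ : ℂ) (γ : ℝ → ℂ) : Prop where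
  contDiff : ContDiff ℝ 1 γ
  mem : ∀ t, γ t ∈ Ω
  eq_left : ∀ t ≤ 0, γ t = w₁
  eq_right : ∀ t ≥ 1, γ t = w₂

/-- The Hurwitz length of a globally defined path, restricted to `[0,1]`. -/
def hurwitzLength (Ω : Set ℂ) (γ : ℝ → ℂ) : ℝ :=
  ∫ t in (0:ℝ)..1, hurwitzDensity Ω (γ t) * ‖deriv γ t‖

namespace IsStationaryPath

variable {Ω : Set ℂ} {a w₁ w₂ w₃ : ℂ} {γ γ₁ γ₂ : ℝ → ℂ}

theorem isPathIn (h : IsStationaryPath Ω w₁ w₂ γ) : IsPathIn Ω w₁ w₂ γ :=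
  ⟨h.eq_left 0 le_rfl, h.eq_right 1 le_rfl, fun t _ => h.mem t, h.contDiff.contDiffOn⟩

theorem differentiable (h : IsStationaryPath Ω w₁ w₂ γ) : Differentiable ℝ γ :=
  h.contDiff.differentiable one_ne_zero

theorem derivWithin_eq (h : IsStationaryPath Ω w₁ w₂ γ) {t : ℝ} (ht : t ∈ Icc (0 : ℝ) 1) :
    derivWithin γ (Icc 0 1) t = deriv γ t :=
  (h.differentiable t).derivWithin (uniqueDiffOn_Icc zero_lt_one t ht)

theorem hurwitzLength_eq (h : IsStationaryPath Ω w₁ w₂ γ) :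
    hurwitzLength Ω γ =
      ∫ t in (0:ℝ)..1, hurwitzDensity Ω (γ t) * ‖derivWithin γ (Set.Icc (0:ℝ) 1) t‖ := by
  refine intervalIntegral.integral_congr fun t ht => ?_
  rw [uIcc_of_le zero_le_one] at ht
  simp only [h.derivWithin_eq ht]

theorem intervalIntegrable (hΩ : IsOpen Ω) (ha : a ∉ Ω) (h : IsStationaryPath Ω w₁ w₂ γ) :
    IntervalIntegrable (fun t => hurwitzDensity Ω (γ t) * ‖deriv γ t‖)
      MeasureTheory.volume 0 1 := by
  refine (intervalIntegrable_hurwitz hΩ ha h.isPathIn).congr fun t ht => ?_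
  rw [uIoc_of_le zero_le_one] at ht
  simp only [h.derivWithin_eq (Ioc_subset_Icc_self ht)]

theorem hurwitzDist_le (h : IsStationaryPath Ω w₁ w₂ γ) :
    hurwitzDist Ω w₁ w₂ ≤ hurwitzLength Ω γ :=
  h.hurwitzLength_eq ▸ _root_.hurwitzDist_le h.isPathIn

theorem symm (h : IsStationaryPath Ω w₁ w₂ γ) :
    IsStationaryPath Ω w₂ w₁ (fun t => γ (1 - t)) where
  contDiff := h.contDiff.comp (contDiff_const.sub contDiff_id)
  mem t := h.mem _
  eq_left t ht := h.eq_right _ (by linarith)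
  eq_right t ht := h.eq_left _ (by linarith)

theorem hurwitzLength_symm (Ω : Set ℂ) (γ : ℝ → ℂ) :
    hurwitzLength Ω (fun t => γ (1 - t)) = hurwitzLength Ω γ := by
  unfold hurwitzLength
  simp only [deriv_comp_const_sub, norm_neg]
  rw [intervalIntegral.integral_comp_sub_left
    (fun t => hurwitzDensity Ω (γ t) * ‖deriv γ t‖) 1]
  simp

theorem trans_eq_left (h₂ : IsStationaryPath Ω w₂ w₃ γ₂) {t : ℝ} (ht : t ≤ 1 / 2) :
    γ₁ (2 * t) + γ₂ (2 * t - 1) - w₂ = γ₁ (2 * t) := by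
  rw [h₂.eq_left _ (by linarith), add_sub_cancel_right]

theorem trans_eq_right (h₁ : IsStationaryPath Ω w₁ w₂ γ₁) {t : ℝ} (ht : 1 / 2 ≤ t) :
    γ₁ (2 * t) + γ₂ (2 * t - 1) - w₂ = γ₂ (2 * t - 1) := by
  rw [h₁.eq_right _ (by linarith), add_sub_cancel_left]

theorem trans (h₁ : IsStationaryPath Ω w₁ w₂ γ₁) (h₂ : IsStationaryPath Ω w₂ w₃ γ₂) :
    IsStationaryPath Ω w₁ w₃ (fun t => γ₁ (2 * t) + γ₂ (2 * t - 1) - w₂) where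
  contDiff := ((h₁.contDiff.comp (contDiff_const.mul contDiff_id)).add
    (h₂.contDiff.comp ((contDiff_const.mul contDiff_id).sub contDiff_const))).sub contDiff_const
  mem t := by
    rcases le_total t (1 / 2) with ht | ht
    · rw [h₂.trans_eq_left ht]
      exact h₁.mem _
    · rw [h₁.trans_eq_right ht]
      exact h₂.mem _
  eq_left t ht := by
    rw [h₂.trans_eq_left (by linarith)]
    exact h₁.eq_left _ (by linarith)
  eq_right t ht := by
    rw [h₁.trans_eq_right (by linarith)]
    exact h₂.eq_right _ (by linarith)

theorem hurwitzLength_trans (hΩ : IsOpen Ω) (ha : a ∉ Ω) (h₁ : IsStationaryPath Ω w₁ w₂ γ₁)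
    (h₂ : IsStationaryPath Ω w₂ w₃ γ₂) :
    hurwitzLength Ω (fun t => γ₁ (2 * t) + γ₂ (2 * t - 1) - w₂) =
      hurwitzLength Ω γ₁ + hurwitzLength Ω γ₂ := by
  have hint := (h₁.trans h₂).intervalIntegrable hΩ ha
  have hleft : ∀ t ∈ Ioo (0 : ℝ) (1 / 2),
      deriv (fun t => γ₁ (2 * t) + γ₂ (2 * t - 1) - w₂) t = (2 : ℝ) • deriv γ₁ (2 * t) := by
    intro t ht
    rw [← deriv_comp_mul_left]
    refine Filter.EventuallyEq.deriv_eq ?_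
    filter_upwards [Iio_mem_nhds ht.2] with s hs using h₂.trans_eq_left (le_of_lt hs)
  have hright : ∀ t ∈ Ioo (1 / 2 : ℝ) 1,
      deriv (fun t => γ₁ (2 * t) + γ₂ (2 * t - 1) - w₂) t = (2 : ℝ) • deriv γ₂ (2 * t - 1) := by
    intro t ht
    have h3 : deriv (fun s => γ₂ (2 * s - 1)) t = (2 : ℝ) • deriv γ₂ (2 * t - 1) := by
      rw [deriv_comp_mul_left 2 (fun s => γ₂ (s - 1)) t, deriv_comp_sub_const]
    rw [← h3]
    refine Filter.EventuallyEq.deriv_eq ?_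
    filter_upwards [Ioi_mem_nhds ht.1] with s hs using h₁.trans_eq_right (le_of_lt hs)
  unfold hurwitzLength
  rw [← intervalIntegral.integral_add_adjacent_intervals (b := 1 / 2)
    (hint.mono_set (by
      rw [uIcc_of_le (by norm_num), uIcc_of_le (by norm_num)]
      exact Icc_subset_Icc le_rfl (by norm_num)))
    (hint.mono_set (by
      rw [uIcc_of_le (by norm_num), uIcc_of_le (by norm_num)]
      exact Icc_subset_Icc (by norm_num) le_rfl))]
  congr 1
  · have h3 := intervalIntegral.mul_integral_comp_mul_left (a := 0) (b := 1 / 2)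
      (f := fun t => hurwitzDensity Ω (γ₁ t) * ‖deriv γ₁ t‖) (2 : ℝ)
    norm_num at h3
    rw [← h3, ← intervalIntegral.integral_const_mul]
    refine intervalIntegral.integral_congr_Ioo_of_le (by norm_num) fun t ht => ?_
    rw [hleft t ht, h₂.trans_eq_left ht.2.le, norm_smul, Real.norm_ofNat]
    ring
  · have h3 := intervalIntegral.mul_integral_comp_mul_sub (a := 1 / 2) (b := 1)
      (f := fun t => hurwitzDensity Ω (γ₂ t) * ‖deriv γ₂ t‖) (2 : ℝ) 1
    norm_num at h3
    rw [← h3, ← intervalIntegral.integral_const_mul]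
    refine intervalIntegral.integral_congr_Ioo_of_le (by norm_num) fun t ht => ?_
    rw [hright t ht, h₁.trans_eq_right ht.1.le, norm_smul, Real.norm_ofNat]
    ring

/-- Every path can be reparametrized to a stationary path of the same Hurwitz length. -/
theorem exists_of_isPathIn (hγ : IsPathIn Ω w₁ w₂ γ) :
    ∃ δ, IsStationaryPath Ω w₁ w₂ δ ∧ hurwitzLength Ω δ =
      ∫ t in (0:ℝ)..1, hurwitzDensity Ω (γ t) * ‖derivWithin γ (Set.Icc (0:ℝ) 1) t‖ := by
  obtain ⟨h0, h1, hm, hc⟩ := hγ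
  set S := Real.smoothTransition with hS
  have hSmem : ∀ t, S t ∈ Icc (0 : ℝ) 1 := fun t =>
    ⟨Real.smoothTransition.nonneg t, Real.smoothTransition.le_one t⟩
  have hSc : ContDiff ℝ 1 S := Real.smoothTransition.contDiff
  have hSd : ∀ t, HasDerivAt S (deriv S t) t := fun t =>
    (hSc.differentiable one_ne_zero t).hasDerivAt
  have hS0 : ∀ t, 0 ≤ deriv S t := fun t => Real.smoothTransition.monotone.deriv_nonneg
  refine ⟨γ ∘ S, ⟨?_, fun t => hm _ (hSmem t), fun t ht => ?_, fun t ht => ?_⟩, ?_⟩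
  · exact contDiffOn_univ.1 (hc.comp hSc.contDiffOn fun t _ => hSmem t)
  · rw [Function.comp_apply, hS, Real.smoothTransition.zero_of_nonpos ht, h0]
  · rw [Function.comp_apply, hS, Real.smoothTransition.one_of_one_le ht, h1]
  · have hder : ∀ t, deriv (γ ∘ S) t = deriv S t • derivWithin γ (Icc 0 1) (S t) := by
      intro t
      have h2 := (hc.differentiableOn one_ne_zero _ (hSmem t)).hasDerivWithinAt
      exact (hasDerivWithinAt_univ.1 (h2.scomp t (hSd t).hasDerivWithinAt
        fun s _ => hSmem s)).deriv
    have hcov := MeasureTheory.integral_Icc_deriv_smul_of_deriv_nonneg (a := 0) (b := 1)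
      (g := fun t => hurwitzDensity Ω (γ t) * ‖derivWithin γ (Set.Icc (0:ℝ) 1) t‖)
      hSc.continuous.continuousOn (fun t _ => hSd t) (fun t _ => hS0 t) zero_le_one
    rw [hS, Real.smoothTransition.zero, Real.smoothTransition.one, ← hS] at hcov
    rw [hurwitzLength, intervalIntegral.integral_of_le zero_le_one,
      intervalIntegral.integral_of_le zero_le_one, ← MeasureTheory.integral_Icc_eq_integral_Ioc,
      ← MeasureTheory.integral_Icc_eq_integral_Ioc, ← hcov]
    refine MeasureTheory.integral_congr_ae (Filter.Eventually.of_forall fun t => ?_)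
    simp only [hder, norm_smul, Real.norm_of_nonneg (hS0 t), Function.comp_apply, smul_eq_mul]
    ring

theorem exists_hurwitzLength_lt (h : ∃ δ, IsStationaryPath Ω w₁ w₂ δ) {ε : ℝ} (hε : 0 < ε) :
    ∃ γ, IsStationaryPath Ω w₁ w₂ γ ∧ hurwitzLength Ω γ < hurwitzDist Ω w₁ w₂ + ε := by
  obtain ⟨δ, hδ⟩ := h
  obtain ⟨L, ⟨γ, hγ, rfl⟩, hL⟩ := exists_lt_of_csInf_lt
    (show Set.Nonempty { L : ℝ | ∃ γ : ℝ → ℂ, IsPathIn Ω w₁ w₂ γ ∧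
      L = ∫ t in (0:ℝ)..1, hurwitzDensity Ω (γ t) * ‖derivWithin γ (Set.Icc (0:ℝ) 1) t‖ } from
      ⟨_, δ, hδ.isPathIn, rfl⟩)
    (show hurwitzDist Ω w₁ w₂ < hurwitzDist Ω w₁ w₂ + ε by linarith)
  obtain ⟨γ', hγ', hlen⟩ := exists_of_isPathIn hγ
  exact ⟨γ', hγ', hlen ▸ hL⟩

end IsStationaryPath

theorem isPathIn_segment {Ω : Set ℂ} {v w : ℂ} (h : segment ℝ v w ⊆ Ω) :
    IsPathIn Ω v w (AffineMap.lineMap v w) := by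
  refine ⟨by simp, by simp, fun t ht => h ?_, (AffineMap.contDiff_lineMap v w).contDiffOn⟩
  rw [segment_eq_image_lineMap]
  exact mem_image_of_mem _ ht

theorem exists_isStationaryPath {Ω : Set ℂ} (hΩ : IsPlaneDomain Ω) {w₁ w₂ : ℂ} (h₁ : w₁ ∈ Ω)
    (h₂ : w₂ ∈ Ω) : ∃ γ, IsStationaryPath Ω w₁ w₂ γ := by
  refine hΩ.2.isPreconnected.induction₂ (fun v w => ∃ γ, IsStationaryPath Ω v w γ) ?_ ?_ ?_ h₁ h₂
  · intro v hv
    obtain ⟨ρ, hρ, hb⟩ := Metric.isOpen_iff.1 hΩ.1 v hv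
    refine mem_nhdsWithin_of_mem_nhds ?_
    filter_upwards [ball_mem_nhds v hρ] with w hw
    obtain ⟨γ, hγ, -⟩ := IsStationaryPath.exists_of_isPathIn (isPathIn_segment
      (((convex_ball v ρ).segment_subset (mem_ball_self hρ) hw).trans hb))
    exact ⟨γ, hγ⟩
  · rintro u v w - - - ⟨γ₁, hγ₁⟩ ⟨γ₂, hγ₂⟩
    exact ⟨_, hγ₁.trans hγ₂⟩
  · rintro u v - - ⟨γ, hγ⟩
    exact ⟨_, hγ.symm⟩

theorem hurwitzDist_le_symm {Ω : Set ℂ} (hΩ : IsPlaneDomain Ω) {w₁ w₂ : ℂ} (h₁ : w₁ ∈ Ω)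
    (h₂ : w₂ ∈ Ω) : hurwitzDist Ω w₁ w₂ ≤ hurwitzDist Ω w₂ w₁ := by
  refine le_of_forall_pos_le_add fun ε hε => ?_
  obtain ⟨γ, hγ, hlt⟩ := IsStationaryPath.exists_hurwitzLength_lt
    (exists_isStationaryPath hΩ h₂ h₁) hε
  have := hγ.symm.hurwitzDist_le
  rw [IsStationaryPath.hurwitzLength_symm] at this
  exact this.trans hlt.le

theorem hurwitzDist_comm {Ω : Set ℂ} (hΩ : IsPlaneDomain Ω) {w₁ w₂ : ℂ} (h₁ : w₁ ∈ Ω)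
    (h₂ : w₂ ∈ Ω) : hurwitzDist Ω w₁ w₂ = hurwitzDist Ω w₂ w₁ :=
  le_antisymm (hurwitzDist_le_symm hΩ h₁ h₂) (hurwitzDist_le_symm hΩ h₂ h₁)

theorem hurwitzDist_triangle {Ω : Set ℂ} {a : ℂ} (hΩ : IsPlaneDomain Ω) (ha : a ∉ Ω)
    {w₁ w₂ w₃ : ℂ} (h₁ : w₁ ∈ Ω) (h₂ : w₂ ∈ Ω) (h₃ : w₃ ∈ Ω) :
    hurwitzDist Ω w₁ w₃ ≤ hurwitzDist Ω w₁ w₂ + hurwitzDist Ω w₂ w₃ := by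
  refine le_of_forall_pos_le_add fun ε hε => ?_
  obtain ⟨γ₁, hγ₁, hlt₁⟩ := IsStationaryPath.exists_hurwitzLength_lt
    (exists_isStationaryPath hΩ h₁ h₂) (half_pos hε)
  obtain ⟨γ₂, hγ₂, hlt₂⟩ := IsStationaryPath.exists_hurwitzLength_lt
    (exists_isStationaryPath hΩ h₂ h₃) (half_pos hε)
  have := (hγ₁.trans hγ₂).hurwitzDist_le
  rw [IsStationaryPath.hurwitzLength_trans hΩ.1 ha hγ₁ hγ₂] at this
  linarith

theorem IsStationaryPath.log_le_hurwitzLength {Ω : Set ℂ} {a w₁ w₂ : ℂ} {γ : ℝ → ℂ}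
    (hΩ : IsOpen Ω) (ha : a ∉ Ω) (h : IsStationaryPath Ω w₁ w₂ γ) :
    Real.log (1 + ‖w₂ - w₁‖ / ‖w₁ - a‖) ≤ 2048 * hurwitzLength Ω γ := by
  have h0 : γ 0 = w₁ := h.eq_left 0 le_rfl
  have h1 : γ 1 = w₂ := h.eq_right 1 le_rfl
  set D := ‖w₁ - a‖ with hD
  have hDpos : 0 < D := by
    rw [hD, norm_pos_iff, sub_ne_zero]
    exact ne_of_mem_of_not_mem (h0 ▸ h.mem 0) ha
  have hcont : Continuous (deriv γ) := h.contDiff.continuous_deriv le_rfl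
  set l : ℝ → ℝ := fun t => ∫ s in (0:ℝ)..t, ‖deriv γ s‖ with hl
  have hl' : ∀ t, HasDerivAt l ‖deriv γ t‖ t := fun t =>
    intervalIntegral.integral_hasDerivAt_right (hcont.norm.intervalIntegrable _ _)
      (hcont.norm.stronglyMeasurableAtFilter _ _) hcont.norm.continuousAt
  have hlc : Continuous l := continuous_iff_continuousAt.2 fun t => (hl' t).continuousAt
  have hγl : ∀ t, 0 ≤ t → ‖γ t - w₁‖ ≤ l t := by
    intro t ht
    have h2 : ∫ s in (0:ℝ)..t, deriv γ s = γ t - γ 0 :=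
      intervalIntegral.integral_deriv_eq_sub (fun s _ => h.differentiable s)
        (hcont.intervalIntegrable _ _)
    rw [← h0, ← h2]
    exact intervalIntegral.norm_integral_le_integral_norm ht
  have hpos : ∀ t, 0 ≤ t → 0 < D + l t := fun t ht =>
    add_pos_of_pos_of_nonneg hDpos ((norm_nonneg _).trans (hγl t ht))
  have hci : IntervalIntegrable (fun t => ‖deriv γ t‖ / (D + l t)) MeasureTheory.volume 0 1 := by
    refine ContinuousOn.intervalIntegrable ?_
    rw [uIcc_of_le zero_le_one]
    exact hcont.norm.continuousOn.div (continuous_const.add hlc).continuousOn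
      fun t ht => (hpos t ht.1).ne'
  have hftc : ∫ t in (0:ℝ)..1, ‖deriv γ t‖ / (D + l t) =
      Real.log (D + l 1) - Real.log (D + l 0) := by
    refine intervalIntegral.integral_eq_sub_of_hasDerivAt (f := fun t => Real.log (D + l t))
      (fun t ht => ?_) hci
    rw [uIcc_of_le zero_le_one] at ht
    exact ((hl' t).const_add D).log (hpos t ht.1).ne'
  have hl0 : l 0 = 0 := by simp [hl]
  have hmono : ∫ t in (0:ℝ)..1, ‖deriv γ t‖ / (D + l t) ≤
      ∫ t in (0:ℝ)..1, 2048 * (hurwitzDensity Ω (γ t) * ‖deriv γ t‖) := by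
    refine intervalIntegral.integral_mono_on zero_le_one hci
      ((h.intervalIntegrable hΩ ha).const_mul _) fun t ht => ?_
    have h2 := le_hurwitzDensity hΩ ha (h.mem t)
    have h3 : ‖γ t - a‖ ≤ D + l t := by
      calc ‖γ t - a‖ = ‖(w₁ - a) + (γ t - w₁)‖ := by ring_nf
        _ ≤ D + ‖γ t - w₁‖ := norm_add_le _ _
        _ ≤ D + l t := by linarith [hγl t ht.1]
    have h4 : 0 < ‖γ t - a‖ :=
      norm_pos_iff.2 (sub_ne_zero.2 (ne_of_mem_of_not_mem (h.mem t) ha))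
    have h5 : 1 / (D + l t) ≤ 2048 * hurwitzDensity Ω (γ t) := by
      calc 1 / (D + l t) ≤ 1 / ‖γ t - a‖ := one_div_le_one_div_of_le h4 h3
        _ = 2048 * (1 / (2048 * ‖γ t - a‖)) := by field_simp
        _ ≤ _ := by gcongr
    calc ‖deriv γ t‖ / (D + l t) = 1 / (D + l t) * ‖deriv γ t‖ := by ring
      _ ≤ 2048 * hurwitzDensity Ω (γ t) * ‖deriv γ t‖ := by gcongr
      _ = _ := by ring
  rw [intervalIntegral.integral_const_mul, hftc, hl0, add_zero,
    ← Real.log_div (hpos 1 zero_le_one).ne' hDpos.ne'] at hmono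
  refine le_trans (Real.log_le_log (by positivity) ?_) hmono
  have h6 := hγl 1 zero_le_one
  rw [h1] at h6
  rw [add_div, div_self hDpos.ne']
  gcongr

/-- Lower bound for the Hurwitz distance in terms of Euclidean distances. -/
theorem log_le_hurwitzDist {Ω : Set ℂ} {a w₁ w₂ : ℂ} (hΩ : IsPlaneDomain Ω) (ha : a ∉ Ω)
    (h₁ : w₁ ∈ Ω) (h₂ : w₂ ∈ Ω) :
    Real.log (1 + ‖w₂ - w₁‖ / ‖w₁ - a‖) ≤ 2048 * hurwitzDist Ω w₁ w₂ := by
  refine le_of_forall_pos_le_add fun ε hε => ?_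
  obtain ⟨γ, hγ, hlt⟩ := IsStationaryPath.exists_hurwitzLength_lt
    (exists_isStationaryPath hΩ h₁ h₂) (show 0 < ε / 2048 by positivity)
  have := hγ.log_le_hurwitzLength hΩ.1 ha
  linarith

theorem norm_sub_le_of_hurwitzDist {Ω : Set ℂ} {a w₁ w₂ : ℂ} (hΩ : IsPlaneDomain Ω) (ha : a ∉ Ω)
    (h₁ : w₁ ∈ Ω) (h₂ : w₂ ∈ Ω) {ε : ℝ} (hε : 0 < ε)
    (h : hurwitzDist Ω w₁ w₂ < Real.log (1 + ε) / 2048) : ‖w₂ - w₁‖ ≤ ε * ‖w₁ - a‖ := by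
  have h3 := log_le_hurwitzDist hΩ ha h₁ h₂
  have h4 : 0 < ‖w₁ - a‖ := norm_pos_iff.2 (sub_ne_zero.2 (ne_of_mem_of_not_mem h₁ ha))
  have h5 : Real.log (1 + ‖w₂ - w₁‖ / ‖w₁ - a‖) ≤ Real.log (1 + ε) := by linarith
  rw [Real.log_le_log_iff (by positivity) (by positivity), add_le_add_iff_left,
    div_le_iff₀ h4] at h5
  exact h5

theorem hurwitzDist_pos {Ω : Set ℂ} {a w₁ w₂ : ℂ} (hΩ : IsPlaneDomain Ω) (ha : a ∉ Ω)
    (h₁ : w₁ ∈ Ω) (h₂ : w₂ ∈ Ω) (hne : w₁ ≠ w₂) : 0 < hurwitzDist Ω w₁ w₂ := by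
  have h3 := log_le_hurwitzDist hΩ ha h₁ h₂
  have h4 : 0 < ‖w₁ - a‖ := norm_pos_iff.2 (sub_ne_zero.2 (ne_of_mem_of_not_mem h₁ ha))
  have h5 : 0 < ‖w₂ - w₁‖ := norm_pos_iff.2 (sub_ne_zero.2 hne.symm)
  have h6 : 0 < Real.log (1 + ‖w₂ - w₁‖ / ‖w₁ - a‖) :=
    Real.log_pos (lt_add_of_pos_right _ (div_pos h5 h4))
  linarith

/-- Local upper bound for the Hurwitz distance in terms of the Euclidean distance. -/
theorem hurwitzDist_le_of_ball_subset {Ω : Set ℂ} {a w v : ℂ} (hΩ : IsOpen Ω) (ha : a ∉ Ω)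
    {ρ : ℝ} (hρ : 0 < ρ) (hb : ball w (2 * ρ) ⊆ Ω) (hv : v ∈ ball w ρ) :
    hurwitzDist Ω v w ≤ 2 / ρ * ‖w - v‖ := by
  have hseg : segment ℝ v w ⊆ ball w ρ := (convex_ball w ρ).segment_subset hv (mem_ball_self hρ)
  have hpath : IsPathIn Ω v w (AffineMap.lineMap v w) :=
    isPathIn_segment (hseg.trans ((ball_subset_ball (by linarith)).trans hb))
  refine (hurwitzDist_le hpath).trans ?_
  have hmono := intervalIntegral.integral_mono_on (zero_le_one' ℝ)
    (intervalIntegrable_hurwitz hΩ ha hpath)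
    (intervalIntegrable_const (c := 2 / ρ * ‖w - v‖)) fun t ht => ?_
  · simpa using hmono
  · have hd : derivWithin (AffineMap.lineMap v w : ℝ → ℂ) (Icc 0 1) t = w - v :=
      AffineMap.hasDerivWithinAt_lineMap.derivWithin (uniqueDiffOn_Icc zero_lt_one t ht)
    have hmem : (AffineMap.lineMap v w : ℝ → ℂ) t ∈ ball w ρ := hseg (by
      rw [segment_eq_image_lineMap]
      exact mem_image_of_mem _ ht)
    rw [hd]
    refine mul_le_mul_of_nonneg_right (hurwitzDensity_le_of_ball_subset ha hρ ?_) (norm_nonneg _)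
    refine Subset.trans (ball_subset_ball' ?_) hb
    rw [mem_ball] at hmem
    linarith

theorem hurwitzDist_complete {Ω : Set ℂ} {a : ℂ} (hΩ : IsPlaneDomain Ω) (ha : a ∉ Ω)
    {u : ℕ → ℂ} (hu : ∀ n, u n ∈ Ω)
    (hcauchy : ∀ ε : ℝ, 0 < ε → ∃ N : ℕ, ∀ m ≥ N, ∀ n ≥ N, hurwitzDist Ω (u m) (u n) < ε) :
    ∃ w ∈ Ω, ∀ ε : ℝ, 0 < ε → ∃ N : ℕ, ∀ n ≥ N, hurwitzDist Ω (u n) w < ε := by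
  have hnear : ∀ ε : ℝ, 0 < ε → ∃ N : ℕ, ∀ b ∉ Ω, ∀ m ≥ N, ∀ n ≥ N,
      ‖u n - u m‖ ≤ ε * ‖u m - b‖ := by
    intro ε hε
    obtain ⟨N, hN⟩ := hcauchy (Real.log (1 + ε) / 2048)
      (div_pos (Real.log_pos (by linarith)) (by norm_num))
    exact ⟨N, fun b hb m hm n hn =>
      norm_sub_le_of_hurwitzDist hΩ hb (hu m) (hu n) hε (hN m hm n hn)⟩
  obtain ⟨N₀, hN₀⟩ := hnear 1 one_pos
  set R := ‖u N₀ - a‖ with hR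
  have hRpos : 0 < R :=
    norm_pos_iff.2 (sub_ne_zero.2 (ne_of_mem_of_not_mem (hu N₀) ha))
  have hbdd : ∀ n ≥ N₀, ‖u n - a‖ ≤ 2 * R := by
    intro n hn
    have h1 := hN₀ a ha N₀ le_rfl n hn
    calc ‖u n - a‖ = ‖(u n - u N₀) + (u N₀ - a)‖ := by ring_nf
      _ ≤ ‖u n - u N₀‖ + ‖u N₀ - a‖ := norm_add_le _ _
      _ ≤ 2 * R := by linarith
  have hseq : CauchySeq u := by
    rw [Metric.cauchySeq_iff]
    intro ε hε
    obtain ⟨N, hN⟩ := hnear (ε / (4 * R)) (by positivity)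
    refine ⟨max N N₀, fun m hm n hn => ?_⟩
    rw [dist_comm, dist_eq_norm]
    calc ‖u n - u m‖ ≤ ε / (4 * R) * ‖u m - a‖ :=
          hN a ha m (le_of_max_le_left hm) n (le_of_max_le_left hn)
      _ ≤ ε / (4 * R) * (2 * R) := by
          gcongr
          exact hbdd m (le_of_max_le_right hm)
      _ = ε / 2 := by field_simp; norm_num
      _ < ε := by linarith
  obtain ⟨w, hw⟩ := cauchySeq_tendsto_of_complete hseq
  have hwΩ : w ∈ Ω := by
    by_contra hwn
    obtain ⟨N, hN⟩ := hnear (1 / 2) (by norm_num)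
    have hlim : Filter.Tendsto (fun n => ‖u n - u N‖) Filter.atTop (nhds ‖w - u N‖) :=
      (hw.sub_const _).norm
    have hle : ‖w - u N‖ ≤ 1 / 2 * ‖u N - w‖ :=
      le_of_tendsto hlim (Filter.eventually_atTop.2 ⟨N, hN w hwn N le_rfl⟩)
    have hpos : 0 < ‖u N - w‖ :=
      norm_pos_iff.2 (sub_ne_zero.2 (ne_of_mem_of_not_mem (hu N) hwn))
    rw [norm_sub_rev] at hle
    linarith
  refine ⟨w, hwΩ, fun ε hε => ?_⟩
  obtain ⟨ρ, hρ, hb⟩ := Metric.isOpen_iff.1 hΩ.1 w hwΩ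
  have hρ2 : 0 < ρ / 2 := half_pos hρ
  have hlim : Filter.Tendsto (fun n => 2 / (ρ / 2) * ‖w - u n‖) Filter.atTop (nhds 0) := by
    simpa using ((hw.const_sub w).norm.const_mul (2 / (ρ / 2)))
  obtain ⟨N, hN⟩ := Filter.eventually_atTop.1
    ((hw.eventually (ball_mem_nhds w hρ2)).and (hlim.eventually (gt_mem_nhds hε)))
  refine ⟨N, fun n hn => lt_of_le_of_lt ?_ (hN n hn).2⟩
  exact hurwitzDist_le_of_ball_subset hΩ.1 ha hρ2 (by rwa [mul_div_cancel₀ _ two_ne_zero])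
    (hN n hn).1

/-- on a hyperbolic domain, the Hurwitz distance makes `Ω` a
complete metric space. -/
theorem hurwitz_complete_metric
    (Ω : Set ℂ) (hΩ : IsPlaneDomain Ω)
    (hhyp : ∃ a b : ℂ, a ∉ Ω ∧ b ∉ Ω ∧ a ≠ b) :
    (∀ w₁ ∈ Ω, ∀ w₂ ∈ Ω, hurwitzDist Ω w₁ w₂ = hurwitzDist Ω w₂ w₁) ∧
    (∀ w₁ ∈ Ω, ∀ w₂ ∈ Ω, ∀ w₃ ∈ Ω,
      hurwitzDist Ω w₁ w₃ ≤ hurwitzDist Ω w₁ w₂ + hurwitzDist Ω w₂ w₃) ∧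
    (∀ w₁ ∈ Ω, ∀ w₂ ∈ Ω, w₁ ≠ w₂ → 0 < hurwitzDist Ω w₁ w₂) ∧
    (∀ u : ℕ → ℂ, (∀ n, u n ∈ Ω) →
      (∀ ε : ℝ, 0 < ε → ∃ N : ℕ, ∀ m ≥ N, ∀ n ≥ N, hurwitzDist Ω (u m) (u n) < ε) →
      ∃ w ∈ Ω, ∀ ε : ℝ, 0 < ε → ∃ N : ℕ, ∀ n ≥ N, hurwitzDist Ω (u n) w < ε) := by
  obtain ⟨a, -, ha, -, -⟩ := hhyp
  exact ⟨fun w₁ h₁ w₂ h₂ => hurwitzDist_comm hΩ h₁ h₂,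
    fun w₁ h₁ w₂ h₂ w₃ h₃ => hurwitzDist_triangle hΩ ha h₁ h₂ h₃,
    fun w₁ h₁ w₂ h₂ hne => hurwitzDist_pos hΩ ha h₁ h₂ hne,
    fun u hu hcauchy => hurwitzDist_complete hΩ ha hu hcauchy⟩
end
end

section
/- Let Y be a proper subdomain of ℂ and let Ω be a proper subdomain of ℂ. Then for every point w ∈ Ω, the generalized Hurwitz density dominates the Hurwitz density: η_Ω^Y(w) ≥ η_Ω(w). -/
open Complex Set Metric
open scoped ENNReal

noncomputable section

/-- The set of derivatives whose supremum is the Hurwitz radius of `Ω` at `w`. -/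
def hurwitzDerivSet (Ω : Set ℂ) (w : ℂ) : Set ℝ :=
  { r : ℝ | 0 < r ∧ ∃ h : ℂ → ℂ, DifferentiableOn ℂ h unitDisk ∧
    Set.MapsTo h unitDisk Ω ∧ h 0 = w ∧ (∀ t ∈ unitDisk, t ≠ 0 → h t ≠ w) ∧
    deriv h 0 = (r : ℂ) }

/-- Postcomposing with an admissible map scales admissible derivatives by `‖deriv h s‖`; a rotation
of the disk makes the derivative of the composite positive. -/
lemma mul_norm_deriv_mem_hurwitzDerivSet {Y Ω : Set ℂ} (hY : IsOpen Y) {s w : ℂ} (hs : s ∈ Y)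
    {h : ℂ → ℂ} (hd : DifferentiableOn ℂ h Y) (hm : Set.MapsTo h Y Ω) (hsw : h s = w)
    (hne : ∀ t ∈ Y, t ≠ s → h t ≠ w) (hh : deriv h s ≠ 0) {r : ℝ}
    (hr : r ∈ hurwitzDerivSet Y s) : r * ‖deriv h s‖ ∈ hurwitzDerivSet Ω w := by
  obtain ⟨hr0, g, gd, gm, g0, gne, gr⟩ := hr
  have hc : 0 < ‖deriv h s‖ := norm_pos_iff.2 hh
  obtain ⟨u, hu, hcu⟩ : ∃ u : ℂ, ‖u‖ = 1 ∧ deriv h s * u = (‖deriv h s‖ : ℂ) := by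
    have hc' : (‖deriv h s‖ : ℂ) ≠ 0 := by exact_mod_cast hc.ne'
    refine ⟨‖deriv h s‖ / deriv h s, ?_, by field_simp⟩
    rw [norm_div, Complex.norm_real, norm_norm, div_self hc.ne']
  have hu0 : u ≠ 0 := norm_ne_zero_iff.1 (by simp [hu])
  have um : Set.MapsTo (fun t : ℂ => u * t) unitDisk unitDisk := by
    intro t ht
    simpa [unitDisk, hu] using ht
  refine ⟨mul_pos hr0 hc, fun t => h (g (u * t)), ?_, hm.comp (gm.comp um), ?_, ?_, ?_⟩
  · exact hd.comp (gd.comp (by fun_prop) um) (gm.comp um)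
  · simp [g0, hsw]
  · intro t ht ht0
    have h1 := gne _ (um ht) (mul_ne_zero hu0 ht0)
    exact hne _ (gm (um ht)) h1
  · have e1 : HasDerivAt (fun t : ℂ => u * t) u 0 := by
      simpa using (hasDerivAt_id (0 : ℂ)).const_mul u
    have e2 : HasDerivAt g r (u * 0) := by
      rw [mul_zero, ← gr]
      exact (gd.differentiableAt (Metric.ball_mem_nhds 0 one_pos)).hasDerivAt
    have e3 : HasDerivAt h (deriv h s) (g (u * 0)) := by
      rw [mul_zero, g0]
      exact (hd.differentiableAt (hY.mem_nhds hs)).hasDerivAt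
    have e4 : HasDerivAt (fun t : ℂ => h (g (u * t))) (deriv h s * (r * u)) 0 :=
      HasDerivAt.comp (h₂ := h) 0 e3 (HasDerivAt.comp (h₂ := g) 0 e2 e1)
    rw [e4.deriv]
    push_cast
    rw [← hcu]
    ring

lemma hurwitzDerivSet_nonempty {Y : Set ℂ} (hY : IsOpen Y) {s : ℂ} (hs : s ∈ Y) :
    (hurwitzDerivSet Y s).Nonempty := by
  obtain ⟨ε, hε, hb⟩ := Metric.isOpen_iff.1 hY s hs
  have hε' : (ε : ℂ) ≠ 0 := by exact_mod_cast hε.ne'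
  refine ⟨ε, hε, fun t => s + ε * t, by fun_prop, ?_, by simp, ?_, ?_⟩
  · intro t ht
    apply hb
    have ht' : ‖t‖ < 1 := by simpa [unitDisk] using ht
    have : ε * ‖t‖ < ε := by nlinarith
    simpa [abs_of_pos hε] using this
  · intro t _ ht0
    simp [hε', ht0]
  · simp

/-- the generalized Hurwitz density dominates the Hurwitz density. -/
theorem genHurwitz_ge_hurwitz
    (Y Ω : Set ℂ) (hY : IsPlaneDomain Y) (hYp : Y ≠ Set.univ)
    (hΩ : IsPlaneDomain Ω) (hΩp : Ω ≠ Set.univ) (w : ℂ) (hw : w ∈ Ω) :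
    ENNReal.ofReal (hurwitzDensity Ω w) ≤ genHurwitzDensity Y Ω w := by
  refine le_sInf ?_
  rintro x ⟨s, hs, h, hd, hm, hsw, hne, hh, rfl⟩
  apply ENNReal.ofReal_le_ofReal
  have hc : 0 < ‖deriv h s‖ := norm_pos_iff.2 hh
  change 2 / sSup (hurwitzDerivSet Ω w) ≤ 2 / sSup (hurwitzDerivSet Y s) / ‖deriv h s‖
  by_cases hb : BddAbove (hurwitzDerivSet Ω w)
  · have hle : ∀ r ∈ hurwitzDerivSet Y s, r ≤ sSup (hurwitzDerivSet Ω w) / ‖deriv h s‖ := by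
      intro r hr
      rw [le_div_iff₀ hc]
      exact le_csSup hb (mul_norm_deriv_mem_hurwitzDerivSet hY.1 hs hd hm hsw hne hh hr)
    obtain ⟨r, hr⟩ := hurwitzDerivSet_nonempty hY.1 hs
    have hpos : 0 < sSup (hurwitzDerivSet Y s) := hr.1.trans_le (le_csSup ⟨_, hle⟩ hr)
    rw [div_div]
    refine div_le_div_of_nonneg_left zero_le_two (mul_pos hpos hc) ?_
    rw [← le_div_iff₀ hc]
    exact csSup_le ⟨r, hr⟩ hle
  · rw [Real.sSup_of_not_bddAbove hb, div_zero]
    have : 0 ≤ sSup (hurwitzDerivSet Y s) := Real.sSup_nonneg fun r hr => hr.1.le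
    positivity
end
end
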